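/- For every binary path P, f(P) = 1 if and only if all valleys of P have the same height. -/

import Mathlib

/-- A binary path is a list of steps: `true` = upstep `u`, `false` = downstep `d`. -/
abbrev BinPath := List Bool

/-- `ht P k` is the height of the `k`-th point of the path `P` (the point reached
after the first `k` steps). -/
def ht (P : BinPath) (k : ℕ) : ℤ :=
  ((P.take k).map (fun b => if b then (1 : ℤ) else -1)).sum

/-- The lattice order on binary paths of the same length: `P ≤ Q` iff
`hᵢ(P) ≤ hᵢ(Q)` for all `i`. -/
def pathLe (P Q : BinPath) : Prop :=
  P.length = Q.length ∧ ∀ k, ht P k ≤ ht Q k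

def pathLt (P Q : BinPath) : Prop := pathLe P Q ∧ P ≠ Q

/-- The maximum path `1ₙ = uⁿ`. -/
def maxPath (n : ℕ) : BinPath := List.replicate n true

/-- Step `i` (0-based) of `P` is a downstep whose endpoint is a valley, i.e. it is
followed by an upstep or it is the last step of `P`. -/
def isValley (P : BinPath) (i : ℕ) : Prop :=
  i < P.length ∧ P.getD i true = false ∧ P.getD (i + 1) true = true

/-- The number of valleys of `P`. -/
def numValleys (P : BinPath) : ℕ :=
  ((Finset.range P.length).filter
    (fun i => P.getD i true = false ∧ P.getD (i + 1) true = true)).card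

/-- The filling of `P`: every valley of `P` is turned into a peak
(each occurrence `du` whose middle point is a valley becomes `ud`, and a final
valley-`d` becomes `u`). -/
def fill (P : BinPath) : BinPath :=
  List.ofFn (fun i : Fin P.length =>
    if P.get i then P.getD (i.1 - 1) true else P.getD (i.1 + 1) true)

/-- The degree of `P`: the least `k` such that the `k`-fold iterated filling
of `P` is the maximum path. -/
noncomputable def degree (P : BinPath) : ℕ :=
  sInf {k | fill^[k] P = maxPath P.length}

/-- `fPath P` is the number of chains from `P` to the maximum path `1_{|P|}` of
length `degree P` having small intervals. -/
noncomputable def fPath (P : BinPath) : ℕ :=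
  Set.ncard {c : ℕ → BinPath |
    c 0 = P ∧ (∀ i, degree P ≤ i → c i = maxPath P.length) ∧
    ∀ i < degree P, pathLt (c i) (c (i + 1)) ∧ pathLe (c (i + 1)) (fill (c i))}

/-- Height of the lowest valley of `P`. -/
noncomputable def lv (P : BinPath) : ℤ :=
  sInf {h : ℤ | ∃ i, isValley P i ∧ ht P (i + 1) = h}

/-- Height of the highest valley of `P`. -/
noncomputable def hv (P : BinPath) : ℤ :=
  sSup {h : ℤ | ∃ i, isValley P i ∧ ht P (i + 1) = h}

noncomputable def hvNat (P : BinPath) : ℕ := (hv P).toNat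

/-- `P′`: every low valley of `P` is turned into a peak. -/
noncomputable def lowFill (P : BinPath) : BinPath :=
  List.ofFn (fun i : Fin P.length =>
    if P.get i then
      (if P.getD (i.1 - 1) true = false ∧ ht P i.1 = lv P then false else true)
    else
      (if P.getD (i.1 + 1) true = true ∧ ht P (i.1 + 1) = lv P then true else false))

/-- `P*`: every valley of `P` is turned into a peak, except the last one when `P`
ends with a downstep. -/
def starFill (P : BinPath) : BinPath :=
  List.ofFn (fun i : Fin P.length =>
    if i.1 + 1 = P.length ∧ P.get i = false then false
    else if P.get i then P.getD (i.1 - 1) true else P.getD (i.1 + 1) true)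

/-- A Dyck path: starts and ends at height 0 and lies weakly above height 0. -/
def IsDyck (P : BinPath) : Prop := ht P P.length = 0 ∧ ∀ k, 0 ≤ ht P k

/-- A Dyck prefix: a prefix of a Dyck path. -/
def IsDyckPrefix (P : BinPath) : Prop := ∃ Q : BinPath, IsDyck (P ++ Q)

/-- A Dyck suffix: a suffix of a Dyck path. -/
def IsDyckSuffix (P : BinPath) : Prop := ∃ Q : BinPath, IsDyck (Q ++ P)

/-- The pyramid `u^m d^m`. -/
def pyramid (m : ℕ) : BinPath := List.replicate m true ++ List.replicate m false

/-- Cardinality of the interval `[P, Q]` in the lattice of binary paths. -/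
noncomputable def intervalCard (P Q : BinPath) : ℕ :=
  Set.ncard {R : BinPath | pathLe P R ∧ pathLe R Q}

/-- `I(s) = |[s, u^{|s|/2} d^{|s|/2}]|`. -/
noncomputable def Ifun (s : BinPath) : ℕ := intervalCard s (pyramid (s.length / 2))

/-- `J(P) = |[P, u^{|P|}]|`. -/
noncomputable def Jfun (P : BinPath) : ℕ := intervalCard P (maxPath P.length)

/-- `P` and `Q` have exactly the same valleys at every height at most `m`. -/
def sameValleysUpTo (P Q : BinPath) (m : ℤ) : Prop :=
  ∀ (i : ℕ) (t : ℤ), t ≤ m →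
    ((isValley P i ∧ ht P (i + 1) = t) ↔ (isValley Q i ∧ ht Q (i + 1) = t))

/-- A multichain of Dyck paths of type `V` from `a` to `s`: it has length
`h = hv(a)` and for every `j ∈ [h]` its `(j-1)`-st and `j`-th members have the
same valleys at every height at most `h - j`.  (The function `σ` is frozen from
index `h` on, so that such multichains are counted correctly.) -/
def IsVChain (a s : BinPath) (σ : ℕ → BinPath) : Prop :=
  σ 0 = a ∧ (∀ j, hvNat a ≤ j → σ j = s) ∧ (∀ j, IsDyck (σ j)) ∧
  (∀ j < hvNat a, pathLe (σ j) (σ (j + 1))) ∧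
  (∀ j, 1 ≤ j → j ≤ hvNat a →
    sameValleysUpTo (σ (j - 1)) (σ j) ((hvNat a : ℤ) - (j : ℤ)))

/-- `V(a,s)`: the number of `a`–`s` multichains of type `V`. -/
noncomputable def VPath (a s : BinPath) : ℕ :=
  Set.ncard {σ : ℕ → BinPath | IsVChain a s σ}

/-- `ζ^k(P,Q)`: the number of `P`–`Q` multichains of length `k`. -/
noncomputable def zetaPow (k : ℕ) (P Q : BinPath) : ℕ :=
  Set.ncard {c : ℕ → BinPath |
    c 0 = P ∧ (∀ i, k ≤ i → c i = Q) ∧ ∀ i < k, pathLe (c i) (c (i + 1))}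

/-- The join of two paths of the same length (pointwise max of heights). -/
def pathSup (P Q : BinPath) : BinPath :=
  List.ofFn (fun i : Fin P.length =>
    decide (max (ht P i.1) (ht Q i.1) < max (ht P (i.1 + 1)) (ht Q (i.1 + 1))))

/-- The meet of two paths of the same length (pointwise min of heights). -/
def pathInf (P Q : BinPath) : BinPath :=
  List.ofFn (fun i : Fin P.length =>
    decide (min (ht P i.1) (ht Q i.1) < min (ht P (i.1 + 1)) (ht Q (i.1 + 1))))

/-- `Q` covers `P` in the lattice of binary paths. -/
def pathCovBy (P Q : BinPath) : Prop :=
  pathLt P Q ∧ ∀ R : BinPath, pathLt P R → pathLt R Q → False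

/-- `l(P,Q) = (1/2)·Σᵢ (hᵢ(Q) − hᵢ(P))`. -/
def lpq (P Q : BinPath) : ℕ :=
  ((∑ i ∈ Finset.range P.length, (ht Q (i + 1) - ht P (i + 1))) / 2).toNat

/-- Convolution in the incidence algebra of the lattice of binary paths. -/
noncomputable def conv (F G : BinPath → BinPath → ℤ) : BinPath → BinPath → ℤ :=
  fun P Q => ∑ᶠ (R : BinPath) (_ : pathLe P R ∧ pathLe R Q), F P R * G R Q

/-- The delta function of the incidence algebra. -/
def deltaFun : BinPath → BinPath → ℤ := fun P Q => if P = Q then 1 else 0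

/-- `μ^k`: the `k`-th convolution power of `μ` (`μ^0` is the delta function). -/
noncomputable def muPow (mu : BinPath → BinPath → ℤ) (k : ℕ) : BinPath → BinPath → ℤ :=
  (conv mu)^[k] deltaFun

@[simp] lemma ht_zero (P : BinPath) : ht P 0 = 0 := by simp [ht]

lemma ht_succ (P : BinPath) {i : ℕ} (hi : i < P.length) :
    ht P (i + 1) = ht P i + if P.getD i true then 1 else -1 := by
  rw [ht, ht, List.take_add_one, List.map_append, List.sum_append, List.getD_eq_getElem _ _ hi,
    List.getElem?_eq_getElem hi]
  simp

lemma ht_of_length_le (P : BinPath) {k : ℕ} (hk : P.length ≤ k) : ht P k = ht P P.length := by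
  simp [ht, List.take_of_length_le hk]

lemma ht_le_self (P : BinPath) {k : ℕ} (hk : k ≤ P.length) : ht P k ≤ k := by
  induction k with
  | zero => simp
  | succ k ih =>
    have := ih (by omega)
    rw [ht_succ P (by omega)]
    split_ifs <;> push_cast <;> omega

lemma ht_parity (P : BinPath) {k : ℕ} (hk : k ≤ P.length) : (ht P k - k) % 2 = 0 := by
  induction k with
  | zero => simp
  | succ k ih =>
    have := ih (by omega)
    rw [ht_succ P (by omega)]
    split_ifs <;> push_cast <;> omega

lemma ht_succ_cases (P : BinPath) {i : ℕ} (hi : i < P.length) :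
    (P.getD i true = true ∧ ht P (i + 1) = ht P i + 1) ∨
      (P.getD i true = false ∧ ht P (i + 1) = ht P i - 1) := by
  rw [ht_succ P hi]
  cases P.getD i true <;> simp
  rfl

lemma isValley_iff_ht (P : BinPath) (i : ℕ) :
    isValley P i ↔ i < P.length ∧ ht P (i + 1) = ht P i - 1 ∧
      (i + 1 < P.length → ht P (i + 2) = ht P (i + 1) + 1) := by
  unfold isValley
  by_cases hi : i < P.length
  · by_cases hi' : i + 1 < P.length
    · have h₁ := ht_succ_cases P hi
      have h₂ := ht_succ_cases P hi'
      grind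
    · have h₁ := ht_succ_cases P hi
      have h₂ : P.getD (i + 1) true = true := by
        rw [List.getD_eq_default _ _ (by omega)]
      grind
  · simp [hi]

lemma path_ext_ht {P Q : BinPath} (hl : P.length = Q.length)
    (h : ∀ k ≤ P.length, ht P k = ht Q k) : P = Q := by
  refine List.ext_getElem hl fun i hi hi' => ?_
  have h₁ := ht_succ_cases P hi
  have h₂ := ht_succ_cases Q hi'
  have h₃ := h i hi.le
  have h₄ := h (i + 1) hi
  rw [List.getD_eq_getElem _ _ hi] at h₁
  rw [List.getD_eq_getElem _ _ hi'] at h₂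
  grind

lemma pathLe_of_ht_le {P Q : BinPath} (hl : P.length = Q.length)
    (h : ∀ k ≤ P.length, ht P k ≤ ht Q k) : pathLe P Q := by
  refine ⟨hl, fun k => ?_⟩
  rcases le_total k P.length with hk | hk
  · exact h k hk
  · rw [ht_of_length_le P hk, ht_of_length_le Q (hl ▸ hk), ← hl]
    exact h _ le_rfl

lemma pathLe_refl (P : BinPath) : pathLe P P := ⟨rfl, fun _ => le_rfl⟩

/-- Every sequence of heights with unit steps comes from a path. -/
lemma exists_path_of_ht (g : ℕ → ℤ) (n : ℕ) (h0 : g 0 = 0)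
    (hg : ∀ i < n, g (i + 1) = g i + 1 ∨ g (i + 1) = g i - 1) :
    ∃ Q : BinPath, Q.length = n ∧ ∀ k ≤ n, ht Q k = g k := by
  refine ⟨List.ofFn fun i : Fin n => decide (g i < g (i + 1)), by simp, fun k hk => ?_⟩
  induction k with
  | zero => simp [h0]
  | succ k ih =>
    have hk' : k < n := hk
    rw [ht_succ _ (by simpa using hk'), ih (by omega), List.getD_eq_getElem _ _ (by simpa using hk')]
    rcases hg k hk' with h | h <;> simp [h]
    omega

@[simp] lemma length_maxPath (n : ℕ) : (maxPath n).length = n := by simp [maxPath]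

lemma ht_maxPath {n k : ℕ} (hk : k ≤ n) : ht (maxPath n) k = k := by
  simp [ht, maxPath, hk]

@[simp] lemma length_fill (P : BinPath) : (fill P).length = P.length := by simp [fill]

@[simp] lemma length_iterate_fill (P : BinPath) (i : ℕ) : (fill^[i] P).length = P.length := by
  induction i with
  | zero => rfl
  | succ i ih => rw [Function.iterate_succ_apply', length_fill, ih]

open Classical in
lemma ht_fill_succ (P : BinPath) {i : ℕ} (hi : i < P.length) :
    ht (fill P) (i + 1) = ht P (i + 1) + if isValley P i then 2 else 0 := by
  have step : ∀ {j : ℕ}, j < P.length → (fill P).getD j true =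
      if P.getD j true then P.getD (j - 1) true else P.getD (j + 1) true := by
    intro j hj
    rw [List.getD_eq_getElem _ _ (by simpa using hj), List.getD_eq_getElem P _ hj]
    simp [fill]
  induction i with
  | zero =>
    rw [ht_succ _ (by simpa using hi), ht_succ P hi, step hi]
    simp only [isValley, ht_zero]
    grind
  | succ i ih =>
    have ih := ih (by omega)
    rw [ht_succ _ (by simpa using hi), ih, ht_succ P hi, step hi]
    simp only [isValley]
    grind

/-- All points of the path which do not lie on the initial run of upsteps have height
at least `m`. -/
def AboveFloor (m : ℤ) (P : BinPath) : Prop := ∀ j ≤ P.length, min (j : ℤ) m ≤ ht P j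

lemma eq_maxPath_of_aboveFloor {P : BinPath} (h : AboveFloor (P.length - 1) P) :
    P = maxPath P.length := by
  refine path_ext_ht (by simp) fun k hk => ?_
  rw [ht_maxPath hk]
  have h₁ := h k hk
  have h₂ := ht_parity P hk
  have h₃ := ht_le_self P hk
  omega

lemma aboveFloor_maxPath (m : ℤ) (n : ℕ) : AboveFloor m (maxPath n) := by
  intro j hj
  rw [ht_maxPath (by simpa using hj)]
  exact min_le_left _ _

lemma aboveFloor_fill {m : ℤ} {P : BinPath} (h : AboveFloor m P) :
    AboveFloor (m + 1) (fill P) := by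
  rintro (_ | j) hj
  · simp
  · rw [length_fill] at hj
    rw [ht_fill_succ P hj]
    have h₁ := h (j + 1) hj
    have h₂ := ht_parity P hj
    have h₃ := h j (by omega)
    have h₄ := ht_succ_cases P hj
    split_ifs with hv
    · push_cast at *; omega
    · rw [isValley_iff_ht] at hv
      by_cases hj' : j + 1 < P.length
      · have h₅ := h (j + 2) hj'
        have h₆ := ht_succ_cases P hj'
        push_cast at *
        grind
      · push_cast at *
        grind

lemma aboveFloor_iterate_fill {m : ℤ} {P : BinPath} (h : AboveFloor m P) (i : ℕ) :
    AboveFloor (m + i) (fill^[i] P) := by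
  induction i with
  | zero => simpa using h
  | succ i ih =>
    rw [Function.iterate_succ_apply', Nat.cast_succ, ← add_assoc]
    exact aboveFloor_fill ih

lemma aboveFloor_of_le_fill {m : ℤ} {P R : BinPath} (hR : pathLe R (fill P))
    (h : AboveFloor (m + 1) R) (hm : m + 1 ≤ P.length - 1) : AboveFloor m P := by
  have hl : R.length = P.length := by simpa using hR.1
  have hf : ∀ j ≤ P.length, min (j : ℤ) (m + 1) ≤ ht (fill P) j :=
    fun j hj => (h j (hl ▸ hj)).trans (hR.2 j)
  rintro (_ | j) hj
  · simp
  · by_contra hlt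
    have h₁ := hf (j + 1) hj
    have h₂ := ht_parity P hj
    rw [ht_fill_succ P hj] at h₁
    split_ifs at h₁ with hv
    · have hv' := (isValley_iff_ht P j).1 hv
      by_cases hj' : j + 1 < P.length
      · have h₃ := hf (j + 2) hj'
        have hn : ¬ isValley P (j + 1) := by
          rw [isValley_iff_ht]
          grind
        rw [ht_fill_succ P hj', if_neg hn] at h₃
        push_cast at *
        grind
      · have h₃ := hf j (by omega)
        have h₄ := ht_parity P hj
        rcases j with _ | j
        · simp only [ht_zero] at *
          push_cast at *
          omega
        · have hn : ¬ isValley P j := by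
            rw [isValley_iff_ht]
            grind
          rw [ht_fill_succ P (by omega), if_neg hn] at h₃
          push_cast at *
          omega
    · push_cast at *
      omega

/-- A chain with small intervals reaching the maximum in `k` steps forces lower bounds. -/
lemma aboveFloor_of_chain {n k : ℕ} {c : ℕ → BinPath} (hk : c k = maxPath n)
    (hc : ∀ i < k, pathLe (c (i + 1)) (fill (c i))) {d : ℕ} (hd : d ≤ k) :
    (c (k - d)).length = n ∧ AboveFloor ((n : ℤ) - 1 - d) (c (k - d)) := by
  induction d with
  | zero => simpa [hk] using aboveFloor_maxPath _ n
  | succ d ih =>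
    obtain ⟨hl, hf⟩ := ih (by omega)
    have h := hc (k - (d + 1)) (by omega)
    rw [show k - (d + 1) + 1 = k - d by omega] at h
    have hl' : (c (k - (d + 1))).length = n := by
      rw [← length_fill, ← h.1, hl]
    refine ⟨hl', aboveFloor_of_le_fill h ?_ ?_⟩
    · convert hf using 1
      push_cast
      ring
    · rw [hl']
      push_cast
      omega

lemma aboveFloor_of_iterate_fill {k : ℕ} {P : BinPath} (h : fill^[k] P = maxPath P.length) :
    AboveFloor ((P.length : ℤ) - 1 - k) P := by
  simpa using (aboveFloor_of_chain (c := fun i => fill^[i] P) h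
    (fun i _ => by rw [Function.iterate_succ_apply']; exact pathLe_refl _) le_rfl).2

lemma iterate_fill_eq_maxPath {k : ℕ} {P : BinPath}
    (h : AboveFloor ((P.length : ℤ) - 1 - k) P) : fill^[k] P = maxPath P.length := by
  have := aboveFloor_iterate_fill h k
  rw [sub_add_cancel] at this
  simpa using eq_maxPath_of_aboveFloor (P := fill^[k] P) (by simpa using this)

lemma neg_le_ht (P : BinPath) {k : ℕ} (hk : k ≤ P.length) : -(k : ℤ) ≤ ht P k := by
  induction k with
  | zero => simp
  | succ k ih =>
    have := ih (by omega)
    rw [ht_succ P (by omega)]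
    split_ifs <;> push_cast <;> omega

lemma iterate_fill_degree (P : BinPath) : fill^[degree P] P = maxPath P.length := by
  refine Nat.sInf_mem (s := {k | fill^[k] P = maxPath P.length}) ⟨2 * P.length, ?_⟩
  refine iterate_fill_eq_maxPath fun j hj => ?_
  have := neg_le_ht P hj
  push_cast
  omega

lemma iterate_fill_ne_maxPath {P : BinPath} {i : ℕ} (hi : i < degree P) :
    fill^[i] P ≠ maxPath P.length :=
  fun h => Nat.notMem_of_lt_sInf hi h

lemma exists_isValley_of_ht_lt {P : BinPath} {j : ℕ} (hj : j ≤ P.length) (h : ht P j < j) :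
    ∃ i, isValley P i ∧ ht P (i + 1) ≤ ht P j := by
  obtain ⟨v, hv, hmin⟩ := Finset.exists_min_image
    ((Finset.range (P.length + 1)).filter fun j => ht P j < j) (ht P)
    ⟨j, by simp; omega⟩
  simp only [Finset.mem_filter, Finset.mem_range] at hv hmin
  have hvj := hmin j ⟨by omega, h⟩
  rcases v with _ | v
  · simp at hv
  · refine ⟨v, ?_, hvj⟩
    rw [isValley_iff_ht]
    have h₁ := ht_succ_cases P (i := v) (by omega)
    have h₂ := hmin v
    refine ⟨by omega, by push_cast at *; omega, fun hlt => ?_⟩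
    have h₃ := ht_succ_cases P hlt
    have h₄ := hmin (v + 2)
    rw [show v + 1 + 1 = v + 2 from rfl] at h₃
    push_cast at *
    omega

lemma pathLe_fill (P : BinPath) : pathLe P (fill P) := by
  refine pathLe_of_ht_le (by simp) ?_
  rintro (_ | k) hk
  · simp
  · rw [ht_fill_succ P hk]
    split_ifs <;> omega

lemma pathLt_fill {P : BinPath} (h : P ≠ maxPath P.length) : pathLt P (fill P) := by
  refine ⟨pathLe_fill P, fun heq => h ?_⟩
  refine path_ext_ht (by simp) fun k hk => ?_
  rw [ht_maxPath hk]
  by_contra hne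
  obtain ⟨i, hi, -⟩ := exists_isValley_of_ht_lt hk (lt_of_le_of_ne (ht_le_self P hk) hne)
  have := ht_fill_succ P hi.1
  rw [← heq, if_pos hi] at this
  omega

lemma ht_lt_of_isValley {P : BinPath} {i : ℕ} (h : isValley P i) : ht P (i + 1) < i := by
  have h₁ := (isValley_iff_ht P i).1 h
  have h₂ := ht_le_self P h.1.le
  omega

lemma ht_le_of_isValley_fill {P : BinPath} {m : ℤ}
    (h : ∀ i, isValley P i → ht P (i + 1) ≤ m) {i : ℕ} (hi : isValley (fill P) i) :
    ht (fill P) (i + 1) ≤ m + 1 := by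
  obtain ⟨hl, h₁, h₂⟩ := (isValley_iff_ht _ _).1 hi
  rw [length_fill] at hl h₂
  by_cases hv : isValley P i
  · have hv' := (isValley_iff_ht P i).1 hv
    have h₃ := ht_fill_succ P hl
    rw [if_pos hv] at h₃
    rcases i with _ | i
    · simp only [ht_zero] at *
      omega
    · have hn : ¬ isValley P i := by
        rw [isValley_iff_ht]
        grind
      have h₄ := ht_fill_succ P (i := i) (by omega)
      rw [if_neg hn] at h₄
      omega
  · have h₃ := ht_fill_succ P hl
    rw [if_neg hv] at h₃
    rw [isValley_iff_ht] at hv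
    have h₅ := ht_succ_cases P hl
    rcases h₅ with h₅ | h₅
    · rcases i with _ | i
      · simp only [ht_zero] at *
        omega
      · have h₄ := ht_fill_succ P (i := i) (by omega)
        split_ifs at h₄ with hw
        · have := h i hw
          omega
        · omega
    · by_cases hl' : i + 1 < P.length
      · have h₄ := ht_fill_succ P hl'
        have h₆ := ht_succ_cases P hl'
        have h₇ := h₂ hl'
        rw [show i + 1 + 1 = i + 2 from rfl] at h₄ h₆
        split_ifs at h₄ with hw
        · have := h _ hw
          rw [show i + 1 + 1 = i + 2 from rfl] at this
          omega
        · grind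
      · grind

lemma eq_fill_of_aboveFloor {P R : BinPath} {m : ℤ}
    (h : ∀ i, isValley P i → ht P (i + 1) ≤ m) (hP : AboveFloor m P) (hPR : pathLe P R)
    (hR : pathLe R (fill P)) (hf : AboveFloor (m + 1) R) : R = fill P := by
  have hl : R.length = P.length := hPR.1.symm
  refine path_ext_ht hR.1 ?_
  rintro (_ | k) hk
  · simp
  · have hk' : k + 1 ≤ P.length := hl ▸ hk
    have h₁ := hR.2 (k + 1)
    have h₂ := hPR.2 (k + 1)
    rw [ht_fill_succ P hk'] at *
    split_ifs at * with hv
    · have h₃ := h k hv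
      have h₄ := hP (k + 1) hk'
      have h₅ := hf (k + 1) hk
      have h₆ := ht_parity P hk'
      have h₇ := ht_parity R hk
      have h₈ := ht_lt_of_isValley hv
      push_cast at *
      omega
    · omega

/-- The chains counted by `fPath`. -/
def smallChains (P : BinPath) : Set (ℕ → BinPath) :=
  {c | c 0 = P ∧ (∀ i, degree P ≤ i → c i = maxPath P.length) ∧
    ∀ i < degree P, pathLt (c i) (c (i + 1)) ∧ pathLe (c (i + 1)) (fill (c i))}

/-- The chain of iterated fillings, stopped once the maximum is reached. -/
noncomputable def fillChain (P : BinPath) (i : ℕ) : BinPath :=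
  if i < degree P then fill^[i] P else maxPath P.length

lemma fillChain_of_le {P : BinPath} {i : ℕ} (h : i ≤ degree P) :
    fillChain P i = fill^[i] P := by
  rcases h.lt_or_eq with h | rfl
  · exact if_pos h
  · rw [iterate_fill_degree]
    exact if_neg (lt_irrefl _)

lemma fillChain_of_ge {P : BinPath} {i : ℕ} (h : degree P ≤ i) :
    fillChain P i = maxPath P.length := if_neg (not_lt.2 h)

lemma fillChain_mem (P : BinPath) : fillChain P ∈ smallChains P := by
  refine ⟨fillChain_of_le (Nat.zero_le _), fun i => fillChain_of_ge, fun i hi => ?_⟩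
  rw [fillChain_of_le hi.le, fillChain_of_le (Nat.succ_le_of_lt hi),
    Function.iterate_succ_apply']
  exact ⟨pathLt_fill (by simpa using iterate_fill_ne_maxPath hi), pathLe_refl _⟩

lemma smallChains_eq_singleton {P : BinPath}
    (h : ∀ i j : ℕ, isValley P i → isValley P j → ht P (i + 1) = ht P (j + 1)) :
    smallChains P = {fillChain P} := by
  refine Set.eq_singleton_iff_unique_mem.2 ⟨fillChain_mem P, ?_⟩
  rintro c ⟨hc0, hcmax, hc⟩
  have hfloor : ∀ i ≤ degree P,
      AboveFloor ((P.length : ℤ) - 1 - degree P + i) (c i) := by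
    intro i hi
    have := (aboveFloor_of_chain (hcmax _ le_rfl) (fun i hi => (hc i hi).2)
      (Nat.sub_le (degree P) i)).2
    rw [Nat.sub_sub_self hi] at this
    convert this using 1
    omega
  have key : ∀ i ≤ degree P, c i = fill^[i] P ∧ (i < degree P →
      ∀ v, isValley (c i) v → ht (c i) (v + 1) ≤ (P.length : ℤ) - 1 - degree P + i) := by
    intro i
    induction i with
    | zero =>
      intro _
      refine ⟨hc0, fun hpos v hv => ?_⟩
      rw [hc0] at hv ⊢
      by_contra hlt
      refine iterate_fill_ne_maxPath (P := P) (i := degree P - 1) (by omega)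
        (iterate_fill_eq_maxPath fun j hj => ?_)
      rcases (ht_le_self P hj).lt_or_eq with hj' | hj'
      · obtain ⟨w, hw, hwj⟩ := exists_isValley_of_ht_lt hj hj'
        have := h v w hv hw
        push_cast [Nat.cast_sub (show 1 ≤ degree P by omega)] at *
        omega
      · rw [hj']
        exact min_le_left _ _
    | succ i ih =>
      intro hi
      obtain ⟨hci, hv⟩ := ih (by omega)
      have hv := hv (by omega)
      have hstep := hc i (by omega)
      have hnext := hfloor (i + 1) hi
      rw [Nat.cast_succ, ← add_assoc] at hnext
      have heq := eq_fill_of_aboveFloor hv (hfloor i (by omega)) hstep.1.1 hstep.2 hnext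
      refine ⟨by rw [Function.iterate_succ_apply', heq, hci], fun _ v hw => ?_⟩
      rw [heq] at hw ⊢
      have := ht_le_of_isValley_fill hv hw
      push_cast
      omega
  funext i
  rcases le_total i (degree P) with hi | hi
  · rw [fillChain_of_le hi, (key i hi).1]
  · rw [fillChain_of_ge hi, hcmax i hi]

open Classical in
/-- Filling every valley but one yields a path. -/
lemma exists_fill_except (P : BinPath) (v : ℕ) :
    ∃ R : BinPath, R.length = P.length ∧ ∀ i < P.length,
      ht R (i + 1) = ht P (i + 1) + if isValley P i ∧ i ≠ v then 2 else 0 := by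
  obtain ⟨R, hl, hR⟩ := exists_path_of_ht
    (fun k => ht P k + if 0 < k ∧ isValley P (k - 1) ∧ k - 1 ≠ v then 2 else 0) P.length
    (by simp) (by
      rintro (_ | i) hi
      · have h₁ := ht_succ_cases P hi
        have h₂ := isValley_iff_ht P 0
        simp only [ht_zero] at *
        grind
      · have h₁ := ht_succ_cases P hi
        have h₂ := isValley_iff_ht P i
        have h₃ := isValley_iff_ht P (i + 1)
        grind)
  refine ⟨R, hl, fun i hi => ?_⟩
  rw [hR (i + 1) hi]
  simp

lemma exists_ne_fillChain {P : BinPath} {i j : ℕ} (hi : isValley P i) (hj : isValley P j)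
    (hij : ht P (i + 1) < ht P (j + 1)) : ∃ c ∈ smallChains P, c ≠ fillChain P := by
  obtain ⟨R, hl, hR⟩ := exists_fill_except P j
  have hne : i ≠ j := by
    rintro rfl
    exact lt_irrefl _ hij
  have hP : P ≠ maxPath P.length := by
    intro h
    have h₁ := ht_lt_of_isValley hi
    rw [h, ht_maxPath hi.1] at h₁
    push_cast at h₁
    omega
  have hpos : 0 < degree P := by
    rcases Nat.eq_zero_or_pos (degree P) with h | h
    · have := iterate_fill_degree P
      rw [h] at this
      exact absurd this hP
    · exact h
  have hfloor := aboveFloor_of_iterate_fill (iterate_fill_degree P)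
  have hPR : pathLe P R := by
    refine pathLe_of_ht_le hl.symm ?_
    rintro (_ | k) hk
    · simp
    · rw [hR k hk]
      split_ifs <;> omega
  have hRf : pathLe R (fill P) := by
    refine pathLe_of_ht_le (by simpa using hl) ?_
    rintro (_ | k) hk
    · simp
    · rw [hR k (hl ▸ hk), ht_fill_succ P (hl ▸ hk)]
      grind
  have hPneR : P ≠ R := by
    intro h
    have := hR i hi.1
    rw [← h, if_pos ⟨hi, hne⟩] at this
    omega
  have hRne : R ≠ fill P := by
    intro h
    have h₁ := hR j hj.1
    rw [h, ht_fill_succ P hj.1, if_pos hj] at h₁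
    simp at h₁
  have hRfloor : AboveFloor ((R.length : ℤ) - 1 - (degree P - 1 : ℕ)) R := by
    have hf := aboveFloor_fill hfloor
    rintro (_ | k) hk
    · simp
    · have hk' : k + 1 ≤ P.length := hl ▸ hk
      have h₁ := hf (k + 1) (by simpa using hk')
      rw [ht_fill_succ P hk'] at h₁
      rw [hR k hk', hl]
      have h₂ := hfloor (i + 1) hi.1
      have h₃ := ht_lt_of_isValley hi
      push_cast [Nat.cast_sub (show 1 ≤ degree P from hpos)] at *
      by_cases hkj : k = j
      · subst hkj
        simp only [ne_eq, not_true_eq_false, and_false, if_false]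
        omega
      · by_cases hv : isValley P k
        · rw [if_pos hv] at h₁
          rw [if_pos ⟨hv, hkj⟩]
          omega
        · rw [if_neg hv] at h₁
          rw [if_neg fun h => hv h.1]
          omega
  have hRmax := iterate_fill_eq_maxPath hRfloor
  have hRlt : ∀ s, s + 1 < degree P → fill^[s] R ≠ maxPath R.length := by
    intro s hs h
    refine iterate_fill_ne_maxPath hs (iterate_fill_eq_maxPath ?_)
    refine aboveFloor_of_le_fill hRf ?_ ?_
    · convert aboveFloor_of_iterate_fill h using 1
      rw [hl]
      push_cast
      ring
    · push_cast
      omega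
  refine ⟨fun s => if s = 0 then P else if s < degree P then fill^[s - 1] R
    else maxPath P.length, ⟨rfl, fun s hs => ?_, fun s hs => ?_⟩, fun h => ?_⟩
  · simp [show s ≠ 0 by omega, not_lt.2 hs]
  · have hnext : (if s + 1 < degree P then fill^[s] R else maxPath P.length) = fill^[s] R := by
      split_ifs with hs'
      · rfl
      · rw [← hl, ← hRmax, show degree P - 1 = s by omega]
    simp only [Nat.add_one_ne_zero, if_false, Nat.add_sub_cancel, hnext, hs, if_true]
    rcases s with _ | s
    · exact ⟨⟨hPR, hPneR⟩, hRf⟩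
    · simp only [Nat.add_one_ne_zero, if_false, Nat.add_sub_cancel,
        Function.iterate_succ_apply']
      exact ⟨pathLt_fill (by simpa using hRlt s hs), pathLe_refl _⟩
  · have h₁ := congrFun h 1
    rw [fillChain_of_le hpos] at h₁
    apply hRne
    by_cases hd : 1 < degree P
    · simpa [hd] using h₁
    · have hd' : degree P - 1 = 0 := by omega
      rw [hd'] at hRmax
      simp only [hd, one_ne_zero, if_false, Function.iterate_one] at h₁
      rw [← h₁, ← hl]
      exact hRmax

/-- For every binary path `P`, `f(P) = 1` iff all valleys of
`P` have the same height. -/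
theorem statement10 (P : BinPath) :
    fPath P = 1 ↔
      ∀ i j : ℕ, isValley P i → isValley P j → ht P (i + 1) = ht P (j + 1) := by
  constructor
  · intro h i j hi hj
    obtain ⟨a, ha⟩ := Set.ncard_eq_one.1 h
    change smallChains P = {a} at ha
    have huniq : ∀ c ∈ smallChains P, c = fillChain P := fun c hc =>
      (Set.mem_singleton_iff.1 (ha ▸ hc)).trans
        (Set.mem_singleton_iff.1 (ha ▸ fillChain_mem P)).symm
    rcases lt_trichotomy (ht P (i + 1)) (ht P (j + 1)) with hlt | heq | hlt
    · obtain ⟨c, hc, hne⟩ := exists_ne_fillChain hi hj hlt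
      exact absurd (huniq c hc) hne
    · exact heq
    · obtain ⟨c, hc, hne⟩ := exists_ne_fillChain hj hi hlt
      exact absurd (huniq c hc) hne
  · intro h
    exact Set.ncard_eq_one.2 ⟨_, smallChains_eq_singleton h⟩
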